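/- Let A be a nonzero m×n real matrix and θ ≥ 0. Then: (i) the set of optimal solutions of the problem: minimize ‖X‖_θ subject to ⟨A,X⟩ ≥ 1, equals (‖A‖_θ*)⁻¹ · ∂‖A‖_θ*, the subdifferential of the dual norm ‖·‖_θ* at A scaled by the reciprocal of ‖A‖_θ*; (ii) the optimal solution is unique if and only if the dual norm function ‖·‖_θ* is differentiable at A. -/

import Mathlib

open scoped BigOperators Pointwise

noncomputable section

namespace LAROS

variable {m n : ℕ}

/-- Trace inner product `⟨A,X⟩ = trace(Aᵀ X)`. -/
def mInner (A X : Matrix (Fin m) (Fin n) ℝ) : ℝ := ∑ i, ∑ j, A i j * X i j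

/-- `N` is a norm on `m×n` real matrices. -/
def IsMatrixNorm (N : Matrix (Fin m) (Fin n) ℝ → ℝ) : Prop :=
  (∀ X, N X = 0 ↔ X = 0) ∧ (∀ (c : ℝ) (X), N (c • X) = |c| * N X) ∧
    (∀ X Y, N (X + Y) ≤ N X + N Y)

/-- Dual norm of `N`. -/
def dualNorm (N : Matrix (Fin m) (Fin n) ℝ → ℝ) (A : Matrix (Fin m) (Fin n) ℝ) : ℝ :=
  sSup {r | ∃ Y, N Y ≤ 1 ∧ r = mInner A Y}

/-- `X` is optimal for: minimize `N X` subject to `⟨A,X⟩ ≥ 1`. -/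
def IsOptMin (N : Matrix (Fin m) (Fin n) ℝ → ℝ) (A X : Matrix (Fin m) (Fin n) ℝ) : Prop :=
  1 ≤ mInner A X ∧ ∀ X', 1 ≤ mInner A X' → N X ≤ N X'

/-- `Y` is optimal for: maximize `⟨A,Y⟩` subject to `N Y ≤ 1`. -/
def IsOptMax (N : Matrix (Fin m) (Fin n) ℝ → ℝ) (A Y : Matrix (Fin m) (Fin n) ℝ) : Prop :=
  N Y ≤ 1 ∧ ∀ Y', N Y' ≤ 1 → mInner A Y' ≤ mInner A Y

/-- Subdifferential of `f : ℝ^{m×n} → ℝ` at `A`, with respect to the trace inner product. -/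
def subdiff (f : Matrix (Fin m) (Fin n) ℝ → ℝ) (A : Matrix (Fin m) (Fin n) ℝ) :
    Set (Matrix (Fin m) (Fin n) ℝ) :=
  {Y | ∀ B, f A + mInner (B - A) Y ≤ f B}

/-- The spectral norm (largest singular value) of an `m×n` real matrix. -/
def spectralNorm (A : Matrix (Fin m) (Fin n) ℝ) : ℝ :=
  sSup {r | ∃ (u : Fin m → ℝ) (v : Fin n → ℝ),
    (∑ i, u i ^ 2) ≤ 1 ∧ (∑ j, v j ^ 2) ≤ 1 ∧ r = ∑ i, ∑ j, u i * A i j * v j}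

/-- The nuclear norm (sum of singular values), as the dual norm of the spectral norm. -/
def nuclearNorm (A : Matrix (Fin m) (Fin n) ℝ) : ℝ := dualNorm spectralNorm A

/-- Entrywise ℓ1 norm: sum of absolute values of all entries. -/
def l1Norm (X : Matrix (Fin m) (Fin n) ℝ) : ℝ := ∑ i, ∑ j, |X i j|

/-- The norm `‖X‖_θ = ‖X‖_* + θ‖X‖₁`. -/
def thetaNorm (θ : ℝ) (X : Matrix (Fin m) (Fin n) ℝ) : ℝ := nuclearNorm X + θ * l1Norm X

attribute [local instance] Matrix.normedAddCommGroup Matrix.normedSpace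

/-- The trace pairing with `C` as a linear functional. -/
def pairing (C : Matrix (Fin m) (Fin n) ℝ) : Matrix (Fin m) (Fin n) ℝ →ₗ[ℝ] ℝ where
  toFun X := mInner C X
  map_add' X Y := by simp [mInner, mul_add, Finset.sum_add_distrib]
  map_smul' c X := by simp [mInner, Finset.mul_sum, mul_left_comm]

lemma mInner_comm (A X : Matrix (Fin m) (Fin n) ℝ) : mInner A X = mInner X A := by
  simp only [mInner, mul_comm]

lemma mInner_add_right (A X Y : Matrix (Fin m) (Fin n) ℝ) :
    mInner A (X + Y) = mInner A X + mInner A Y := (pairing A).map_add X Y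

lemma mInner_smul_right (A : Matrix (Fin m) (Fin n) ℝ) (c : ℝ) (X : Matrix (Fin m) (Fin n) ℝ) :
    mInner A (c • X) = c * mInner A X := (pairing A).map_smul c X

lemma mInner_neg_right (A X : Matrix (Fin m) (Fin n) ℝ) : mInner A (-X) = -mInner A X :=
  (pairing A).map_neg X

lemma mInner_sub_right (A X Y : Matrix (Fin m) (Fin n) ℝ) :
    mInner A (X - Y) = mInner A X - mInner A Y := (pairing A).map_sub X Y

lemma mInner_add_left (A B X : Matrix (Fin m) (Fin n) ℝ) :
    mInner (A + B) X = mInner A X + mInner B X := by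
  simp only [mInner_comm _ X, mInner_add_right]

lemma mInner_smul_left (c : ℝ) (A X : Matrix (Fin m) (Fin n) ℝ) :
    mInner (c • A) X = c * mInner A X := by
  simp only [mInner_comm _ X, mInner_smul_right]

lemma mInner_sub_left (A B X : Matrix (Fin m) (Fin n) ℝ) :
    mInner (A - B) X = mInner A X - mInner B X := by
  simp only [mInner_comm _ X, mInner_sub_right]

lemma mInner_single_right (A : Matrix (Fin m) (Fin n) ℝ) (i : Fin m) (j : Fin n) :
    mInner A (Matrix.single i j 1) = A i j := by
  simp [mInner, Matrix.single_apply, ite_and]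

lemma continuous_mInner_right (A : Matrix (Fin m) (Fin n) ℝ) : Continuous (mInner A) :=
  (pairing A).continuous_of_finiteDimensional

lemma abs_mInner_le (A X : Matrix (Fin m) (Fin n) ℝ) :
    |mInner A X| ≤ (∑ i, ∑ j, |A i j|) * ‖X‖ := by
  simp only [mInner, Finset.sum_mul]
  refine (Finset.abs_sum_le_sum_abs _ _).trans (Finset.sum_le_sum fun i _ => ?_)
  refine (Finset.abs_sum_le_sum_abs _ _).trans (Finset.sum_le_sum fun j _ => ?_)
  rw [abs_mul]
  exact mul_le_mul_of_nonneg_left (Matrix.norm_entry_le_entrywise_sup_norm X) (abs_nonneg _)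

lemma sum_abs_le_card_mul_norm (A : Matrix (Fin m) (Fin n) ℝ) :
    ∑ i, ∑ j, |A i j| ≤ (m * n : ℝ) * ‖A‖ := by
  calc ∑ i, ∑ j, |A i j| ≤ ∑ _i : Fin m, ∑ _j : Fin n, ‖A‖ :=
        Finset.sum_le_sum fun i _ => Finset.sum_le_sum fun j _ =>
          Matrix.norm_entry_le_entrywise_sup_norm A
    _ = (m * n : ℝ) * ‖A‖ := by simp [mul_assoc]

lemma exists_eq_mInner (f : Matrix (Fin m) (Fin n) ℝ →L[ℝ] ℝ) :
    ∃ C, ∀ X, f X = mInner C X := by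
  refine ⟨Matrix.of fun i j => f (Matrix.single i j 1), fun X => ?_⟩
  conv_lhs => rw [Matrix.matrix_eq_sum_single X]
  simp only [map_sum, mInner, Matrix.of_apply]
  refine Finset.sum_congr rfl fun i _ => Finset.sum_congr rfl fun j _ => ?_
  have h : Matrix.single i j (X i j) = X i j • (Matrix.single i j 1 : Matrix (Fin m) (Fin n) ℝ) := by
    simp
  rw [h, map_smul, smul_eq_mul, mul_comm]

lemma subdiff_eq_of_differentiableAt {f : Matrix (Fin m) (Fin n) ℝ → ℝ}
    {A Y Z : Matrix (Fin m) (Fin n) ℝ} (hf : DifferentiableAt ℝ f A)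
    (hY : Y ∈ subdiff f A) (hZ : Z ∈ subdiff f A) : Y = Z := by
  have key : ∀ W ∈ subdiff f A, ∀ B, fderiv ℝ f A B = mInner W B := fun W hW B => by
    have hmin : IsLocalMin (f - ⇑(pairing W).toContinuousLinearMap) A :=
      Filter.Eventually.of_forall fun B => by
        have h := hW B
        rw [mInner_sub_left] at h
        change f A - mInner W A ≤ f B - mInner W B
        rw [mInner_comm W, mInner_comm W]
        linarith
    have h := hmin.hasFDerivAt_eq_zero
      (hf.hasFDerivAt.sub (pairing W).toContinuousLinearMap.hasFDerivAt)
    exact congrArg (fun L => L B) (sub_eq_zero.1 h)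
  ext i j
  rw [← mInner_single_right Y, ← mInner_single_right Z, ← key Y hY, ← key Z hZ]

namespace IsMatrixNorm

variable {N : Matrix (Fin m) (Fin n) ℝ → ℝ}

lemma map_zero (hN : IsMatrixNorm N) : N 0 = 0 := (hN.1 0).2 rfl

lemma map_neg (hN : IsMatrixNorm N) (X : Matrix (Fin m) (Fin n) ℝ) : N (-X) = N X := by
  simpa using hN.2.1 (-1) X

lemma nonneg (hN : IsMatrixNorm N) (X : Matrix (Fin m) (Fin n) ℝ) : 0 ≤ N X := by
  have h := hN.2.2 X (-X)
  rw [add_neg_cancel, hN.map_zero, hN.map_neg] at h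
  linarith

lemma pos (hN : IsMatrixNorm N) {X : Matrix (Fin m) (Fin n) ℝ} (hX : X ≠ 0) : 0 < N X :=
  lt_of_le_of_ne (hN.nonneg X) fun h => hX ((hN.1 X).1 h.symm)

lemma convexOn (hN : IsMatrixNorm N) : ConvexOn ℝ Set.univ N := by
  refine ⟨convex_univ, fun X _ Y _ a b ha hb _ => ?_⟩
  refine (hN.2.2 _ _).trans_eq ?_
  rw [hN.2.1, hN.2.1, abs_of_nonneg ha, abs_of_nonneg hb, smul_eq_mul, smul_eq_mul]

lemma continuous (hN : IsMatrixNorm N) : Continuous N := by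
  have h := hN.convexOn.continuousOn_interior
  rwa [interior_univ, continuousOn_univ] at h

lemma exists_norm_le (hN : IsMatrixNorm N) : ∃ c : ℝ, 0 ≤ c ∧ ∀ X, ‖X‖ ≤ c * N X := by
  rcases (Metric.sphere (0 : Matrix (Fin m) (Fin n) ℝ) 1).eq_empty_or_nonempty with he | hne
  · refine ⟨0, le_rfl, fun X => ?_⟩
    rcases eq_or_ne X 0 with rfl | hX
    · simp
    · have hmem : ‖X‖⁻¹ • X ∈ Metric.sphere (0 : Matrix (Fin m) (Fin n) ℝ) 1 := by
        simp [norm_smul, hX]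
      simp [he] at hmem
  · obtain ⟨Z, hZ, hmin⟩ := (isCompact_sphere (0 : Matrix (Fin m) (Fin n) ℝ) 1).exists_isMinOn hne
      hN.continuous.continuousOn
    have hZ0 : Z ≠ 0 := by rintro rfl; simp at hZ
    have hpos := hN.pos hZ0
    refine ⟨(N Z)⁻¹, by positivity, fun X => ?_⟩
    rcases eq_or_ne X 0 with rfl | hX
    · simp [hN.map_zero]
    · have hmem : ‖X‖⁻¹ • X ∈ Metric.sphere (0 : Matrix (Fin m) (Fin n) ℝ) 1 := by
        simp [norm_smul, hX]
      have h : N Z ≤ N (‖X‖⁻¹ • X) := hmin hmem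
      have hX' : 0 < ‖X‖ := norm_pos_iff.2 hX
      rw [hN.2.1, abs_of_pos (inv_pos.2 hX'), ← div_eq_inv_mul, le_div_iff₀ hX'] at h
      rw [← div_eq_inv_mul, le_div_iff₀ hpos]
      linarith

lemma isCompact_unitBall (hN : IsMatrixNorm N) : IsCompact {Y | N Y ≤ 1} := by
  obtain ⟨c, hc, h⟩ := hN.exists_norm_le
  refine Metric.isCompact_of_isClosed_isBounded (isClosed_le hN.continuous continuous_const) ?_
  refine (Metric.isBounded_closedBall (x := 0) (r := c)).subset fun Y hY => ?_
  rw [mem_closedBall_zero_iff]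
  exact (h Y).trans (mul_le_of_le_one_right hc hY)

lemma bddAbove_dual (hN : IsMatrixNorm N) (A : Matrix (Fin m) (Fin n) ℝ) :
    BddAbove {r | ∃ Y, N Y ≤ 1 ∧ r = mInner A Y} := by
  obtain ⟨M, hM⟩ := hN.isCompact_unitBall.bddAbove_image (continuous_mInner_right A).continuousOn
  exact ⟨M, by rintro _ ⟨Y, hY, rfl⟩; exact hM ⟨Y, hY, rfl⟩⟩

end IsMatrixNorm

/-- The support function of a nonempty bounded symmetric set that separates points is a norm. -/
lemma isMatrixNorm_support {K : Set (Matrix (Fin m) (Fin n) ℝ)} (hne : K.Nonempty)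
    (hneg : ∀ Y ∈ K, -Y ∈ K) (hb : ∀ X, BddAbove {r | ∃ Y ∈ K, r = mInner X Y})
    (hsep : ∀ X, (∀ Y ∈ K, mInner X Y ≤ 0) → X = 0) :
    IsMatrixNorm fun X => sSup {r | ∃ Y ∈ K, r = mInner X Y} := by
  set h : Matrix (Fin m) (Fin n) ℝ → ℝ := fun X => sSup {r | ∃ Y ∈ K, r = mInner X Y}
  have hle : ∀ X, ∀ Y ∈ K, mInner X Y ≤ h X := fun X Y hY => le_csSup (hb X) ⟨Y, hY, rfl⟩
  have hsup : ∀ X M, (∀ Y ∈ K, mInner X Y ≤ M) → h X ≤ M := fun X M hM => by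
    obtain ⟨Y, hY⟩ := hne
    refine csSup_le ⟨_, Y, hY, rfl⟩ ?_
    rintro _ ⟨Z, hZ, rfl⟩
    exact hM Z hZ
  have habs : ∀ X, ∀ Y ∈ K, |mInner X Y| ≤ h X := fun X Y hY =>
    abs_le'.2 ⟨hle X Y hY, by simpa [mInner_neg_right] using hle X (-Y) (hneg Y hY)⟩
  have hsmul : ∀ (c : ℝ) X, h (c • X) ≤ |c| * h X := fun c X =>
    hsup _ _ fun Y hY => by
      rw [mInner_smul_left]
      refine (le_abs_self _).trans ?_
      rw [abs_mul]
      exact mul_le_mul_of_nonneg_left (habs X Y hY) (abs_nonneg c)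
  have hnonneg : ∀ X, 0 ≤ h X := fun X => by
    obtain ⟨Y, hY⟩ := hne
    exact (abs_nonneg _).trans (habs X Y hY)
  refine ⟨fun X => ⟨fun h0 => hsep X fun Y hY => (hle X Y hY).trans_eq h0, ?_⟩, fun c X => ?_,
    fun X Y => ?_⟩
  · rintro rfl
    exact le_antisymm (by simpa using hsmul 0 0) (hnonneg 0)
  · refine le_antisymm (hsmul c X) ?_
    rcases eq_or_ne c 0 with rfl | hc
    · simpa using hnonneg _
    · have h1 := hsmul c⁻¹ (c • X)
      rw [inv_smul_smul₀ hc, abs_inv, ← div_eq_inv_mul, le_div_iff₀ (abs_pos.2 hc)] at h1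
      linarith
  · refine hsup _ _ fun Z hZ => ?_
    rw [mInner_add_left]
    exact add_le_add (hle X Z hZ) (hle Y Z hZ)

lemma isMatrixNorm_dualNorm {N : Matrix (Fin m) (Fin n) ℝ → ℝ} (hN : IsMatrixNorm N) :
    IsMatrixNorm (dualNorm N) := by
  refine isMatrixNorm_support (K := {Y | N Y ≤ 1}) ⟨0, by simp [hN.map_zero]⟩
    (fun Y hY => by simpa [hN.map_neg] using hY) hN.bddAbove_dual fun X hX => ?_
  by_contra h0
  have hpos := hN.pos h0
  have h1 := hX ((N X)⁻¹ • X) (by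
    simp [hN.2.1, abs_of_pos hpos, hpos.ne'])
  rw [mInner_smul_right] at h1
  have h2 : mInner X X ≤ 0 := nonpos_of_mul_nonpos_right h1 (inv_pos.2 hpos)
  refine h0 (Matrix.ext fun i j => ?_)
  have hrow : ∀ i, 0 ≤ ∑ j, X i j * X i j := fun i =>
    Finset.sum_nonneg fun j _ => mul_self_nonneg _
  have h3 : mInner X X = 0 := le_antisymm h2 (Finset.sum_nonneg fun i _ => hrow i)
  have h4 := (Finset.sum_eq_zero_iff_of_nonneg fun i _ => hrow i).1 h3 i (Finset.mem_univ i)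
  have h5 := (Finset.sum_eq_zero_iff_of_nonneg fun j _ => mul_self_nonneg (X i j)).1 h4 j
    (Finset.mem_univ j)
  simpa using h5

lemma isMatrixNorm_spectralNorm :
    IsMatrixNorm (spectralNorm : Matrix (Fin m) (Fin n) ℝ → ℝ) := by
  have hin : ∀ (A : Matrix (Fin m) (Fin n) ℝ) u v,
      mInner A (Matrix.vecMulVec u v) = ∑ i, ∑ j, u i * A i j * v j := fun A u v => by
    simp only [mInner, Matrix.vecMulVec_apply]
    exact Finset.sum_congr rfl fun i _ => Finset.sum_congr rfl fun j _ => by ring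
  set K : Set (Matrix (Fin m) (Fin n) ℝ) := {Y | ∃ (u : Fin m → ℝ) (v : Fin n → ℝ),
    (∑ i, u i ^ 2) ≤ 1 ∧ (∑ j, v j ^ 2) ≤ 1 ∧ Y = Matrix.vecMulVec u v}
  have heq : (spectralNorm : Matrix (Fin m) (Fin n) ℝ → ℝ) =
      fun X => sSup {r | ∃ Y ∈ K, r = mInner X Y} := by
    funext X
    refine congrArg sSup (Set.ext fun r => ⟨?_, ?_⟩)
    · rintro ⟨u, v, hu, hv, rfl⟩
      exact ⟨_, ⟨u, v, hu, hv, rfl⟩, (hin X u v).symm⟩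
    · rintro ⟨_, ⟨u, v, hu, hv, rfl⟩, rfl⟩
      exact ⟨u, v, hu, hv, hin X u v⟩
  have hneg : ∀ Y ∈ K, -Y ∈ K := by
    rintro _ ⟨u, v, hu, hv, rfl⟩
    exact ⟨-u, v, by simpa using hu, hv, by simp⟩
  have hcoord : ∀ {k : ℕ} (w : Fin k → ℝ), ∑ i, w i ^ 2 ≤ 1 → ∀ i, |w i| ≤ 1 := fun w hw i => by
    rw [← sq_le_one_iff_abs_le_one]
    exact (Finset.single_le_sum (f := fun i => w i ^ 2) (fun i _ => sq_nonneg _)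
      (Finset.mem_univ i)).trans hw
  rw [heq]
  refine isMatrixNorm_support ⟨0, 0, 0, by simp, by simp, by simp⟩ hneg (fun X => ?_) fun X hX => ?_
  · refine ⟨∑ i, ∑ j, |X i j|, ?_⟩
    rintro _ ⟨_, ⟨u, v, hu, hv, rfl⟩, rfl⟩
    refine Finset.sum_le_sum fun i _ => Finset.sum_le_sum fun j _ => ?_
    refine (le_abs_self _).trans ?_
    rw [abs_mul, Matrix.vecMulVec_apply, abs_mul]
    exact mul_le_of_le_one_right (abs_nonneg _)
      (mul_le_one₀ (hcoord u hu i) (abs_nonneg _) (hcoord v hv j))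
  · have hsingle : ∀ i j, Matrix.single i j (1 : ℝ) ∈ K := fun i j =>
      ⟨Pi.single i 1, Pi.single j 1, by simp [Pi.single_apply], by simp [Pi.single_apply], by
        simp [Matrix.single_eq_single_vecMulVec_single]⟩
    ext i j
    have h1 := hX _ (hsingle i j)
    have h2 := hX _ (hneg _ (hsingle i j))
    rw [mInner_neg_right] at h2
    rw [mInner_single_right] at h1 h2
    exact le_antisymm h1 (by simpa using h2)

lemma isMatrixNorm_thetaNorm {θ : ℝ} (hθ : 0 ≤ θ) :
    IsMatrixNorm (thetaNorm θ : Matrix (Fin m) (Fin n) ℝ → ℝ) := by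
  have hnuc : IsMatrixNorm (nuclearNorm : Matrix (Fin m) (Fin n) ℝ → ℝ) :=
    isMatrixNorm_dualNorm isMatrixNorm_spectralNorm
  have hl1 : ∀ X : Matrix (Fin m) (Fin n) ℝ, 0 ≤ l1Norm X := fun X =>
    Finset.sum_nonneg fun i _ => Finset.sum_nonneg fun j _ => abs_nonneg _
  refine ⟨fun X => ⟨fun h => (hnuc.1 X).1 ?_, ?_⟩, fun c X => ?_, fun X Y => ?_⟩
  · have h1 := hnuc.nonneg X
    have h2 := mul_nonneg hθ (hl1 X)
    unfold thetaNorm at h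
    linarith
  · rintro rfl
    simp [thetaNorm, hnuc.map_zero, l1Norm]
  · have h : l1Norm (c • X) = |c| * l1Norm X := by simp [l1Norm, abs_mul, Finset.mul_sum]
    rw [thetaNorm, thetaNorm, hnuc.2.1, h]
    ring
  · have h : l1Norm (X + Y) ≤ l1Norm X + l1Norm Y := by
      simp only [l1Norm, ← Finset.sum_add_distrib]
      exact Finset.sum_le_sum fun i _ => Finset.sum_le_sum fun j _ => abs_add_le _ _
    have h1 := hnuc.2.2 X Y
    have h2 := mul_le_mul_of_nonneg_left h hθ
    unfold thetaNorm
    linarith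

namespace IsMatrixNorm

variable {N : Matrix (Fin m) (Fin n) ℝ → ℝ}

lemma mInner_le_dualNorm (hN : IsMatrixNorm N) (A : Matrix (Fin m) (Fin n) ℝ)
    {Y : Matrix (Fin m) (Fin n) ℝ} (hY : N Y ≤ 1) : mInner A Y ≤ dualNorm N A :=
  le_csSup (hN.bddAbove_dual A) ⟨Y, hY, rfl⟩

lemma mInner_le_dualNorm_mul (hN : IsMatrixNorm N) (A X : Matrix (Fin m) (Fin n) ℝ) :
    mInner A X ≤ dualNorm N A * N X := by
  rcases eq_or_ne X 0 with rfl | hX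
  · simp [hN.map_zero, mInner]
  · have hpos := hN.pos hX
    have h := hN.mInner_le_dualNorm A (Y := (N X)⁻¹ • X) (by
      simp [hN.2.1, abs_of_pos hpos, hpos.ne'])
    rwa [mInner_smul_right, ← div_eq_inv_mul, div_le_iff₀ hpos] at h

lemma exists_mInner_eq_dualNorm (hN : IsMatrixNorm N) (A : Matrix (Fin m) (Fin n) ℝ) :
    ∃ Y, N Y ≤ 1 ∧ mInner A Y = dualNorm N A := by
  obtain ⟨Y, hY, hmax⟩ := hN.isCompact_unitBall.exists_isMaxOn ⟨0, by simp [hN.map_zero]⟩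
    (continuous_mInner_right A).continuousOn
  refine ⟨Y, hY, le_antisymm (hN.mInner_le_dualNorm A hY) ?_⟩
  refine csSup_le ⟨_, Y, hY, rfl⟩ ?_
  rintro _ ⟨Z, hZ, rfl⟩
  exact hmax hZ

/-- The bipolar theorem for the unit ball of a norm. -/
lemma le_one_of_forall_mInner_le (hN : IsMatrixNorm N) {Y : Matrix (Fin m) (Fin n) ℝ}
    (h : ∀ C, mInner C Y ≤ dualNorm N C) : N Y ≤ 1 := by
  by_contra hY
  have hconv : Convex ℝ {Y | N Y ≤ 1} := by simpa using hN.convexOn.convex_le 1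
  have : LocallyConvexSpace ℝ (Matrix (Fin m) (Fin n) ℝ) :=
    inferInstanceAs (LocallyConvexSpace ℝ (Fin m → Fin n → ℝ))
  obtain ⟨f, u, hf, hu⟩ := geometric_hahn_banach_closed_point hconv
    (isClosed_le hN.continuous continuous_const) hY
  obtain ⟨C, hC⟩ := exists_eq_mInner f
  obtain ⟨Z, hZ, hZC⟩ := hN.exists_mInner_eq_dualNorm C
  have h1 := hf Z hZ
  have h2 := h C
  rw [hC] at h1 hu
  linarith

lemma mem_subdiff_dualNorm_iff (hN : IsMatrixNorm N) {A Y : Matrix (Fin m) (Fin n) ℝ} :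
    Y ∈ subdiff (dualNorm N) A ↔ N Y ≤ 1 ∧ dualNorm N A ≤ mInner A Y := by
  have hD := isMatrixNorm_dualNorm hN
  refine ⟨fun h => ⟨hN.le_one_of_forall_mInner_le fun C => ?_, ?_⟩, fun h B => ?_⟩
  · have h1 := h (A + C)
    rw [add_sub_cancel_left] at h1
    linarith [hD.2.2 A C]
  · have h1 := h 0
    rw [mInner_sub_left, hD.map_zero] at h1
    have h2 : mInner 0 Y = 0 := by simp [mInner]
    linarith
  · rw [mInner_sub_left]
    linarith [hN.mInner_le_dualNorm B h.1, h.2]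

lemma isOptMin_iff (hN : IsMatrixNorm N) {A X : Matrix (Fin m) (Fin n) ℝ} (hA : A ≠ 0) :
    IsOptMin N A X ↔ dualNorm N A • X ∈ subdiff (dualNorm N) A := by
  have hpos := (isMatrixNorm_dualNorm hN).pos hA
  rw [hN.mem_subdiff_dualNorm_iff, mInner_smul_right, hN.2.1, abs_of_pos hpos]
  refine ⟨fun h => ⟨?_, le_mul_of_one_le_right hpos.le h.1⟩, fun h => ⟨?_, fun X' hX' => ?_⟩⟩
  · obtain ⟨Y, hY, hYA⟩ := hN.exists_mInner_eq_dualNorm A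
    have h1 := h.2 ((dualNorm N A)⁻¹ • Y) (by
      rw [mInner_smul_right, hYA, inv_mul_cancel₀ hpos.ne'])
    rw [hN.2.1, abs_of_pos (inv_pos.2 hpos), ← div_eq_inv_mul, le_div_iff₀ hpos] at h1
    linarith
  · exact le_of_mul_le_mul_left (by simpa using h.2) hpos
  · exact le_of_mul_le_mul_left (h.1.trans (hX'.trans (hN.mInner_le_dualNorm_mul A X'))) hpos

open Filter Topology in
lemma differentiableAt_dualNorm (hN : IsMatrixNorm N) {A Y₀ : Matrix (Fin m) (Fin n) ℝ}
    (hY₀ : Y₀ ∈ subdiff (dualNorm N) A) (huniq : ∀ Y ∈ subdiff (dualNorm N) A, Y = Y₀) :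
    DifferentiableAt ℝ (dualNorm N) A := by
  have hD := isMatrixNorm_dualNorm hN
  choose Y hY1 hYD using hN.exists_mInner_eq_dualNorm
  have hlow : ∀ B, dualNorm N A - 2 * dualNorm N (B - A) ≤ mInner A (Y B) := fun B => by
    have h1 := hD.2.2 B (A - B)
    rw [add_sub_cancel, ← neg_sub B A, hD.map_neg] at h1
    have h2 := hN.mInner_le_dualNorm (B - A) (hY1 B)
    rw [mInner_sub_left, hYD] at h2
    linarith
  have hlim : Tendsto (fun B => dualNorm N A - 2 * dualNorm N (B - A)) (𝓝 A)
      (𝓝 (dualNorm N A)) := by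
    have hc : Continuous fun B => dualNorm N A - 2 * dualNorm N (B - A) := by
      have := hD.continuous
      fun_prop
    simpa [hD.map_zero] using hc.tendsto A
  have htend : Tendsto Y (𝓝 A) (𝓝 Y₀) := by
    refine hN.isCompact_unitBall.tendsto_nhds_of_unique_mapClusterPt
      (Eventually.of_forall hY1) fun Z hZ hcl => huniq Z (hN.mem_subdiff_dualNorm_iff.2 ⟨hZ, ?_⟩)
    by_contra! hlt
    obtain ⟨r, hr1, hr2⟩ := exists_between hlt
    have hfreq := hcl.frequently
      ((continuous_mInner_right A).continuousAt.eventually (gt_mem_nhds hr1))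
    obtain ⟨B, hB1, hB2⟩ := (hfreq.and_eventually (hlim.eventually (lt_mem_nhds hr2))).exists
    linarith [hlow B]
  refine HasFDerivAt.differentiableAt (f' := (pairing Y₀).toContinuousLinearMap) ?_
  refine hasFDerivAt_iff_isLittleO.2 ?_
  have hsmall : (fun B => mInner (B - A) (Y B - Y₀)) =o[𝓝 A] fun B => B - A := by
    have h1 : (fun B => Y B - Y₀) =o[𝓝 A] fun _ => (1 : ℝ) := by
      have h0 := htend.sub_const Y₀
      rw [sub_self] at h0
      exact (Asymptotics.isLittleO_one_iff ℝ).2 h0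
    have h2 := (Asymptotics.isBigO_refl (fun B : Matrix (Fin m) (Fin n) ℝ => ‖B - A‖)
      (𝓝 A)).mul_isLittleO h1.norm_left
    simp only [mul_one] at h2
    refine (Asymptotics.IsBigO.trans_isLittleO (.of_bound (m * n : ℝ) ?_) h2).of_norm_right
    refine Eventually.of_forall fun B => (abs_mInner_le _ _).trans ?_
    rw [norm_mul, norm_norm, norm_norm, ← mul_assoc]
    exact mul_le_mul_of_nonneg_right (sum_abs_le_card_mul_norm _) (norm_nonneg _)
  refine Asymptotics.IsBigO.trans_isLittleO (.of_bound 1 (Eventually.of_forall fun B => ?_)) hsmall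
  have h1 := hY₀ B
  have h2 := hN.mInner_le_dualNorm A (hY1 B)
  change ‖dualNorm N B - dualNorm N A - mInner Y₀ (B - A)‖ ≤ _
  rw [mInner_comm Y₀, one_mul, Real.norm_of_nonneg (by linarith), mInner_sub_right]
  refine le_trans ?_ (Real.le_norm_self _)
  rw [mInner_sub_left _ _ (Y B), hYD]
  linarith

end IsMatrixNorm

theorem stmt6 (θ : ℝ) (hθ : 0 ≤ θ) (A : Matrix (Fin m) (Fin n) ℝ) (hA : A ≠ 0) :
    {X | IsOptMin (thetaNorm θ) A X} =
        (dualNorm (thetaNorm θ) A)⁻¹ • subdiff (dualNorm (thetaNorm θ)) A ∧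
      ((∃! X, IsOptMin (thetaNorm θ) A X) ↔
        DifferentiableAt ℝ (dualNorm (thetaNorm θ)) A) := by
  have hN : IsMatrixNorm (thetaNorm θ : Matrix (Fin m) (Fin n) ℝ → ℝ) := isMatrixNorm_thetaNorm hθ
  have hpos := (isMatrixNorm_dualNorm hN).pos hA
  refine ⟨?_, ?_, fun hdiff => ?_⟩
  · ext X
    rw [Set.mem_inv_smul_set_iff₀ hpos.ne']
    exact hN.isOptMin_iff hA
  · rintro ⟨X, hX, huniq⟩
    refine hN.differentiableAt_dualNorm ((hN.isOptMin_iff hA).1 hX) fun Y hY => ?_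
    have h := huniq ((dualNorm (thetaNorm θ) A)⁻¹ • Y) ((hN.isOptMin_iff hA).2 (by
      rwa [smul_inv_smul₀ hpos.ne']))
    rw [← h, smul_inv_smul₀ hpos.ne']
  · obtain ⟨Y, hY, hYA⟩ := hN.exists_mInner_eq_dualNorm A
    have hYmem := hN.mem_subdiff_dualNorm_iff.2 ⟨hY, hYA.ge⟩
    refine ⟨(dualNorm (thetaNorm θ) A)⁻¹ • Y, (hN.isOptMin_iff hA).2 (by
      rwa [smul_inv_smul₀ hpos.ne']), fun X hX => ?_⟩
    rw [← subdiff_eq_of_differentiableAt hdiff ((hN.isOptMin_iff hA).1 hX) hYmem,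
      inv_smul_smul₀ hpos.ne']

end LAROS
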